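/- Let M be a saturated free algebra on uncountable basis I. Then I is a Morley sequence in p₀: I is an indiscernible set and is independent over ∅ in the sense of forking. -/

import Mathlib

open FirstOrder Language Cardinal Set

universe u v w

namespace Paper

variable {L : FirstOrder.Language.{u, v}}

/-- `a` and `b` (as `n`-tuples) satisfy the same formulas with parameters from `A`. -/
def SameType {M : Type w} [L.Structure M] (A : Set M) {n : ℕ} (a b : Fin n → M) : Prop :=
  ∀ φ : L.Formula (↥A ⊕ Fin n),
    φ.Realize (Sum.elim (fun x => (x : M)) a) ↔ φ.Realize (Sum.elim (fun x => (x : M)) b)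

/-- `a` and `b` satisfy the same formulas over the empty set. -/
def SameType₀ {M : Type w} [L.Structure M] {n : ℕ} (a b : Fin n → M) : Prop :=
  ∀ φ : L.Formula (Fin n), φ.Realize a ↔ φ.Realize b

/-- `M` is `κ`-saturated: every finitely satisfiable (in `M`) collection of formulas in one
variable over a parameter set of size `< κ` is realized in `M`. -/
def IsSat (M : Type w) [L.Structure M] (κ : Cardinal.{w}) : Prop :=
  ∀ A : Set M, #A < κ →
    ∀ p : Set (L.Formula (↥A ⊕ Fin 1)),
      (∀ S : Finset (L.Formula (↥A ⊕ Fin 1)), ↑S ⊆ p →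
        ∃ a : Fin 1 → M, ∀ φ ∈ S, φ.Realize (Sum.elim (fun x => (x : M)) a)) →
      ∃ a : Fin 1 → M, ∀ φ ∈ p, φ.Realize (Sum.elim (fun x => (x : M)) a)

/-- `b` is algebraic over `A` in `M`. -/
def InAcl {M : Type w} [L.Structure M] (A : Set M) (b : M) : Prop :=
  ∃ φ : L.Formula (↥A ⊕ Fin 1),
    φ.Realize (Sum.elim (fun x => (x : M)) (fun _ => b)) ∧
    {x : M | φ.Realize (Sum.elim (fun x => (x : M)) (fun _ => x))}.Finite

/-- A set `I` of `k`-tuples is an indiscernible set: any two injective enumerations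
of `n` elements of `I` satisfy the same formulas over `∅`. -/
def IsIndiscSet {M : Type w} [L.Structure M] {k : ℕ} (I : Set (Fin k → M)) : Prop :=
  ∀ (n : ℕ) (a b : Fin n → (Fin k → M)), Function.Injective a → Function.Injective b →
    (∀ i, a i ∈ I) → (∀ i, b i ∈ I) →
    ∀ φ : L.Formula (Fin n × Fin k),
      (φ.Realize fun p => a p.1 p.2) ↔ (φ.Realize fun p => b p.1 p.2)

/-- The set of all coordinates of the tuples in `I`. -/
def coords {M : Type w} {k : ℕ} (I : Set (Fin k → M)) : Set M :=
  ⋃ e ∈ I, Set.range e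

/-- A theory is almost indiscernible if it has a saturated model of cardinality `ℵ₁` which is
contained in the algebraic closure of an indiscernible set of finite tuples of cardinality `ℵ₁`. -/
def AlmostIndiscernible (T : L.Theory) : Prop :=
  ∃ (M : Type (max u v)) (_ : L.Structure M), M ⊨ T ∧ #M = ℵ₁ ∧ IsSat (L := L) M ℵ₁ ∧
    ∃ (k : ℕ) (I : Set (Fin k → M)), IsIndiscSet (L := L) I ∧ #I = ℵ₁ ∧ ∀ b : M, InAcl (L := L) (coords I) b

/-- A complete type over `A` in one variable, identified with a maximal finitely satisfiable
set of formulas over `A`. -/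
def IsCompleteTypeOver (M : Type w) [L.Structure M] (A : Set M)
    (p : Set (L.Formula (↥A ⊕ Fin 1))) : Prop :=
  (∀ S : Finset (L.Formula (↥A ⊕ Fin 1)), ↑S ⊆ p →
    ∃ a : Fin 1 → M, ∀ φ ∈ S, φ.Realize (Sum.elim (fun x => (x : M)) a)) ∧
  (∀ φ : L.Formula (↥A ⊕ Fin 1), φ ∈ p ∨ φ.not ∈ p)

/-- `T` is `ω`-stable: over every countable parameter set in a model of `T` there are only
countably many complete types. -/
def IsOmegaStable (T : L.Theory) : Prop :=
  ∀ (M : Type (max u v)) (_ : L.Structure M), M ⊨ T →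
    ∀ A : Set M, A.Countable → {p | IsCompleteTypeOver (L := L) M A p}.Countable

section Rank

variable {M : Type w} [L.Structure M]

/-- Realization of a formula with parameters from all of `M`. -/
def RealP {n : ℕ} (φ : L.Formula (M ⊕ Fin n)) (a : Fin n → M) : Prop :=
  φ.Realize (Sum.elim id a)

/-- Morley rank (computed in `M`) of a definable set is at least `α`. -/
def MRGe {n : ℕ} (φ : L.Formula (M ⊕ Fin n)) (α : Ordinal.{0}) : Prop :=
  (∃ a, RealP φ a) ∧ ∀ β < α, ∃ ψ : ℕ → L.Formula (M ⊕ Fin n),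
    (∀ i a, RealP (ψ i) a → RealP φ a) ∧
    (∀ i j, i ≠ j → ∀ a, ¬(RealP (ψ i) a ∧ RealP (ψ j) a)) ∧
    ∀ i, MRGe (ψ i) β
termination_by α
decreasing_by exact ‹_ < α›

/-- Morley rank (computed in `M`) is exactly `α`. -/
def MREq {n : ℕ} (φ : L.Formula (M ⊕ Fin n)) (α : Ordinal.{0}) : Prop :=
  MRGe φ α ∧ ¬ MRGe φ (α + 1)

/-- Every formula over `A` satisfied by `a` has Morley rank at least `α`. -/
def TpRkGe (A : Set M) {n : ℕ} (a : Fin n → M) (α : Ordinal.{0}) : Prop :=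
  ∀ φ : L.Formula (↥A ⊕ Fin n),
    φ.Realize (Sum.elim (fun x => (x : M)) a) →
    MRGe (L := L) (φ.relabel (Sum.map (fun x : ↥A => (x : M)) id)) α

/-- `a` is (forking-)independent from `B` over `A`: the Morley rank of its type does not
drop when the parameters are extended from `A` to `A ∪ B`. -/
def Indep (A : Set M) {n : ℕ} (a : Fin n → M) (B : Set M) : Prop :=
  ∀ α : Ordinal.{0}, TpRkGe (L := L) (A ∪ B) a α ↔ TpRkGe (L := L) A a α

/-- An independent family of realizations: each member is independent from all the others. -/
def IndepFamily (A : Set M) {n : ℕ} {ι : Type*} (J : ι → (Fin n → M)) : Prop :=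
  ∀ i : ι, Indep (L := L) A (J i) (⋃ j ∈ {j | j ≠ i}, Set.range (J j))

/-- `tp(a/A)` is stationary (w.r.t. parameter sets of size `< κ`). -/
def Stationary (κ : Cardinal.{w}) (A : Set M) {n : ℕ} (a : Fin n → M) : Prop :=
  ∀ B : Set M, A ⊆ B → #B < κ → ∀ a' a'' : Fin n → M,
    SameType (L := L) A a' a → SameType (L := L) A a'' a → Indep (L := L) A a' B → Indep (L := L) A a'' B → SameType (L := L) B a' a''

/-- `tp(a/A)` and `tp(b/B)` are nonorthogonal (w.r.t. parameter sets of size `< κ`). -/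
def Nonorthogonal (κ : Cardinal.{w}) (A : Set M) {n : ℕ} (a : Fin n → M)
    (B : Set M) {m : ℕ} (b : Fin m → M) : Prop :=
  ∃ C : Set M, A ∪ B ⊆ C ∧ #C < κ ∧ ∃ (a' : Fin n → M) (b' : Fin m → M),
    SameType (L := L) A a' a ∧ Indep (L := L) A a' C ∧ SameType (L := L) B b' b ∧
    Indep (L := L) B b' C ∧ ¬ Indep (L := L) C a' (Set.range b')

/-- `tp(a/A)` is regular: stationary, nonalgebraic, and orthogonal to all of its forking
extensions. -/
def Regular (κ : Cardinal.{w}) (A : Set M) {n : ℕ} (a : Fin n → M) : Prop :=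
  Stationary (L := L) κ A a ∧ (∃ i, ¬ InAcl (L := L) A (a i)) ∧
  ∀ B : Set M, A ⊆ B → #B < κ → ∀ a' : Fin n → M,
    SameType (L := L) A a' a → ¬ Indep (L := L) A a' B → ¬ Nonorthogonal (L := L) κ A a B a'

/-- U-rank of `tp(a/A)` is at least `α`. -/
def URkGe (κ : Cardinal.{w}) (A : Set M) {n : ℕ} (a : Fin n → M) (α : Ordinal.{0}) : Prop :=
  ∀ β < α, ∃ (B : Set M) (a' : Fin n → M), A ⊆ B ∧ #B < κ ∧
    SameType (L := L) A a' a ∧ ¬ Indep (L := L) A a' B ∧ URkGe κ B a' β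
termination_by α
decreasing_by exact ‹_ < α›

end Rank

section Algebra

/-- The theory `T` is equational: every axiom is a universally quantified equation
between terms. -/
def IsEquational (T : L.Theory) : Prop :=
  ∀ φ ∈ T, ∃ (n : ℕ) (t₁ t₂ : L.Term (Empty ⊕ Fin n)),
    φ = BoundedFormula.alls (t₁.bdEqual t₂)

/-- `A` is free on `X ⊆ A` over the class of models of `T`: `A ⊨ T` and every map from `X`
into a model of `T` extends uniquely to a homomorphism. -/
def IsFreeOn (T : L.Theory) (A : Type w) [L.Structure A] (X : Set A) : Prop :=
  A ⊨ T ∧ ∀ (B : Type w) (_ : L.Structure B), B ⊨ T →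
    ∀ f : X → B, ∃! h : A →[L] B, ∀ x : X, h x = f x

/-- An element of a free algebra is basic if it belongs to some basis. -/
def IsBasic (T : L.Theory) {M : Type w} [L.Structure M] (a : M) : Prop :=
  ∃ X : Set M, a ∈ X ∧ IsFreeOn T M X

/-- A subset of a free algebra is basic if it is contained in some basis. -/
def IsBasicSet (T : L.Theory) {M : Type w} [L.Structure M] (A : Set M) : Prop :=
  ∃ X : Set M, A ⊆ X ∧ IsFreeOn T M X

end Algebra

/-- Tarski–Vaught style: `S` is the underlying set of an elementary substructure. -/
def IsElemSubset {M : Type w} [L.Structure M] (S : Set M) : Prop :=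
  S.Nonempty ∧ ∀ (n : ℕ) (φ : L.Formula (Fin (n + 1))) (a : Fin n → M),
    (∀ i, a i ∈ S) → (∃ x : M, φ.Realize (Fin.snoc a x)) →
    ∃ x ∈ S, φ.Realize (Fin.snoc a x)

/-- Every type over a parameter subset of `S` of size `< κ` that is finitely satisfiable in `M`
is realized inside `S`. -/
def SatInside {M : Type w} [L.Structure M] (S : Set M) (κ : Cardinal.{w}) : Prop :=
  ∀ A : Set M, A ⊆ S → #A < κ →
    ∀ p : Set (L.Formula (↥A ⊕ Fin 1)),
      (∀ Sf : Finset (L.Formula (↥A ⊕ Fin 1)), ↑Sf ⊆ p →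
        ∃ a : Fin 1 → M, ∀ φ ∈ Sf, φ.Realize (Sum.elim (fun x => (x : M)) a)) →
      ∃ a : Fin 1 → M, a 0 ∈ S ∧ ∀ φ ∈ p, φ.Realize (Sum.elim (fun x => (x : M)) a)

end Paper


namespace Paper

section Aux

variable {L : FirstOrder.Language.{u, v}} {M : Type w} [L.Structure M]

/-- A set of pairs is (the graph of) a partial elementary relation. -/
def Elem (L : FirstOrder.Language.{u, v}) [L.Structure M] (S : Set (M × M)) : Prop :=
  ∀ φ : L.Formula S, φ.Realize (fun p => p.1.1) ↔ φ.Realize (fun p => p.1.2)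

theorem Elem.swap {S : Set (M × M)} (h : Elem L S) : Elem L (Prod.swap ⁻¹' S) := by
  intro φ
  have := h (φ.relabel (fun p => ⟨p.1.swap, p.2⟩))
  simp only [Formula.realize_relabel] at this
  exact this.symm

theorem ext_fun (hsat : IsSat (L := L) M ℵ₁) {ι : Type*} [Countable ι] (x y : ι → M)
    (h : ∀ φ : L.Formula ι, φ.Realize x ↔ φ.Realize y) (u : M) :
    ∃ z : M, ∀ φ : L.Formula (ι ⊕ Fin 1),
      φ.Realize (Sum.elim x (fun _ => u)) ↔ φ.Realize (Sum.elim y (fun _ => z)) := by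
  classical
  let A : Set M := Set.range y
  have hA : #A < ℵ₁ := (countable_iff_lt_aleph_one A).1 (Set.countable_range y)
  let g : ι ⊕ Fin 1 → A ⊕ Fin 1 := Sum.map (fun i => ⟨y i, Set.mem_range_self i⟩) id
  have hg : ∀ a : Fin 1 → M, (Sum.elim (fun x : A => (x : M)) a) ∘ g = Sum.elim y a := by
    intro a; funext i; rcases i with i | i <;> rfl
  obtain ⟨a, ha⟩ := hsat A hA
    ((fun φ : L.Formula (ι ⊕ Fin 1) => Formula.relabel g φ) ''
      {φ : L.Formula (ι ⊕ Fin 1) | φ.Realize (Sum.elim x (fun _ => u))}) (by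
    intro S hS
    have hS' : ∀ ψ : S, ∃ φ : L.Formula (ι ⊕ Fin 1),
        φ.Realize (Sum.elim x (fun _ => u)) ∧ Formula.relabel g φ = ψ.1 := fun ψ => by
      obtain ⟨φ, h1, h2⟩ := hS ψ.2
      exact ⟨φ, h1, h2⟩
    choose F hF1 hF2 using hS'
    have := (h ((Formula.iInf F).iExs (Fin 1))).1 (by
      rw [Formula.realize_iExs]
      exact ⟨fun _ => u, Formula.realize_iInf.2 hF1⟩)
    rw [Formula.realize_iExs] at this
    obtain ⟨a, ha⟩ := this
    rw [Formula.realize_iInf] at ha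
    refine ⟨a, fun φ hφ => ?_⟩
    have h3 := ha ⟨φ, hφ⟩
    rw [← hg a, ← Formula.realize_relabel, hF2] at h3
    exact h3)
  have ha' : ∀ φ : L.Formula (ι ⊕ Fin 1), φ.Realize (Sum.elim x (fun _ => u)) →
      φ.Realize (Sum.elim y (fun _ => a 0)) := by
    intro φ hφ
    have := ha _ ⟨φ, hφ, rfl⟩
    simp only [Formula.realize_relabel, hg] at this
    convert this using 2
    funext i; rw [Subsingleton.elim i 0]
  refine ⟨a 0, fun φ => ⟨ha' φ, fun h1 => ?_⟩⟩
  by_contra h2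
  have := ha' φ.not (by simpa using h2)
  rw [Formula.realize_not] at this
  exact this h1

theorem Elem.ext (hsat : IsSat (L := L) M ℵ₁) {S : Set (M × M)} (hS : S.Finite)
    (h : Elem L S) (u : M) : ∃ z : M, Elem L (insert (u, z) S) := by
  classical
  have : Countable S := hS.countable.to_subtype
  obtain ⟨z, hz⟩ := ext_fun hsat (fun p : S => p.1.1) (fun p : S => p.1.2) h u
  refine ⟨z, fun φ => ?_⟩
  let g : ↥(insert (u, z) S) → S ⊕ Fin 1 :=
    fun p => if hp : p.1 ∈ S then Sum.inl ⟨p.1, hp⟩ else Sum.inr 0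
  have := hz (φ.relabel g)
  simp only [Formula.realize_relabel] at this
  convert this using 2
  · funext p
    by_cases hp : p.1 ∈ S
    · simp [g, hp]
    · have : p.1 = (u, z) := by
        rcases p.2 with h | h
        · exact h
        · exact absurd h hp
      simp only [g, Function.comp_apply, dif_neg hp, Sum.elim_inr]; rw [this]
  · funext p
    by_cases hp : p.1 ∈ S
    · simp [g, hp]
    · have : p.1 = (u, z) := by
        rcases p.2 with h | h
        · exact h
        · exact absurd h hp
      simp only [g, Function.comp_apply, dif_neg hp, Sum.elim_inr]; rw [this]

theorem Elem.ext_finset (hsat : IsSat (L := L) M ℵ₁) {S : Set (M × M)} (hS : S.Finite)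
    (h : Elem L S) (X : Finset M) :
    ∃ S', S ⊆ S' ∧ S'.Finite ∧ Elem L S' ∧ ∀ x ∈ X, ∃ z, (x, z) ∈ S' := by
  classical
  induction X using Finset.induction_on with
  | empty => exact ⟨S, subset_rfl, hS, h, by simp⟩
  | insert a X _ ih =>
    obtain ⟨S', h1, h2, h3, h4⟩ := ih
    obtain ⟨z, hz⟩ := h3.ext hsat h2 a
    refine ⟨insert (a, z) S', h1.trans (Set.subset_insert _ _), h2.insert _, hz, ?_⟩
    intro x hx
    rcases Finset.mem_insert.1 hx with rfl | hx
    · exact ⟨z, Set.mem_insert _ _⟩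
    · obtain ⟨y, hy⟩ := h4 x hx
      exact ⟨y, Set.mem_insert_of_mem _ hy⟩

theorem finite_swap {S : Set (M × M)} (hS : S.Finite) : (Prod.swap ⁻¹' S).Finite :=
  hS.preimage Prod.swap_injective.injOn

theorem Elem.step (hsat : IsSat (L := L) M ℵ₁) (supp : M → Finset M) {S : Set (M × M)}
    (hS : S.Finite) (h : Elem L S) :
    ∃ S', S ⊆ S' ∧ S'.Finite ∧ Elem L S' ∧ (∀ p ∈ S, ∀ x ∈ supp p.1, ∃ z, (x, z) ∈ S') ∧
      (∀ p ∈ S, ∀ x ∈ supp p.2, ∃ z, (z, x) ∈ S') := by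
  classical
  obtain ⟨S1, a1, a2, a3, a4⟩ := h.ext_finset hsat hS (hS.toFinset.biUnion (fun p => supp p.1))
  obtain ⟨S2, b1, b2, b3, b4⟩ := a3.swap.ext_finset hsat (finite_swap a2)
    (hS.toFinset.biUnion (fun p => supp p.2))
  have hsub : S1 ⊆ Prod.swap ⁻¹' S2 := fun p hp => b1 (by simpa using hp)
  refine ⟨Prod.swap ⁻¹' S2, a1.trans hsub, finite_swap b2, b3.swap, ?_, ?_⟩
  · intro p hp x hx
    obtain ⟨z, hz⟩ := a4 x (Finset.mem_biUnion.2 ⟨p, by simpa using hp, hx⟩)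
    exact ⟨z, hsub hz⟩
  · intro p hp x hx
    obtain ⟨z, hz⟩ := b4 x (Finset.mem_biUnion.2 ⟨p, by simpa using hp, hx⟩)
    exact ⟨z, hz⟩

theorem Elem.chain (hsat : IsSat (L := L) M ℵ₁) (supp : M → Finset M) {S : Set (M × M)}
    (hS : S.Finite) (h : Elem L S) :
    ∃ R : ℕ → Set (M × M), S = R 0 ∧ Monotone R ∧ (∀ n, (R n).Finite) ∧ (∀ n, Elem L (R n)) ∧
      (∀ n, ∀ p ∈ R n, ∀ x ∈ supp p.1, ∃ z, (x, z) ∈ R (n + 1)) ∧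
      (∀ n, ∀ p ∈ R n, ∀ x ∈ supp p.2, ∃ z, (z, x) ∈ R (n + 1)) := by
  have hstep : ∀ S : {S : Set (M × M) // S.Finite ∧ Elem L S},
      ∃ S' : {S : Set (M × M) // S.Finite ∧ Elem L S}, S.1 ⊆ S'.1 ∧
      (∀ p ∈ S.1, ∀ x ∈ supp p.1, ∃ z, (x, z) ∈ S'.1) ∧
      (∀ p ∈ S.1, ∀ x ∈ supp p.2, ∃ z, (z, x) ∈ S'.1) := by
    rintro ⟨S, h1, h2⟩
    obtain ⟨S', a, b, c, d, e⟩ := h2.step hsat supp h1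
    exact ⟨⟨S', b, c⟩, a, d, e⟩
  choose next n1 n2 n3 using hstep
  let Q : ℕ → {S : Set (M × M) // S.Finite ∧ Elem L S} :=
    fun n => Nat.rec ⟨S, hS, h⟩ (fun _ s => next s) n
  exact ⟨fun n => (Q n).1, rfl, monotone_nat_of_le_succ (fun n => n1 (Q n)),
    fun n => (Q n).2.1, fun n => (Q n).2.2, fun n => n2 (Q n), fun n => n3 (Q n)⟩

/-! ### Free algebras -/

theorem gen {T : L.Theory} (hT : IsEquational T) {I : Set M} (hfree : IsFreeOn T M I) (c : M) :
    ∃ (s : Finset M) (t : L.Term s), (↑s : Set M) ⊆ I ∧ t.realize (fun i : s => (i : M)) = c := by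
  classical
  obtain ⟨hM, hf⟩ := hfree
  have : T.IsUniversal := ⟨by
    intro φ hφ
    obtain ⟨n, t₁, t₂, rfl⟩ := hT φ hφ
    have key : ∀ (n : ℕ) (ψ : L.BoundedFormula Empty n), ψ.IsUniversal → ψ.alls.IsUniversal := by
      intro n
      induction n with
      | zero => intro ψ h; exact h
      | succ n ih => intro ψ h; exact ih _ h.all
    exact key n _ (BoundedFormula.IsAtomic.equal t₁ t₂).isUniversal⟩
  let N := Substructure.closure L I
  have hN : N ⊨ T := inferInstance
  obtain ⟨h, hh, -⟩ := hf N inferInstance hN (fun x => ⟨x, Substructure.subset_closure x.2⟩)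
  obtain ⟨k, hk, huniq⟩ := hf M inferInstance hM (fun x => x)
  have e1 : N.subtype.toHom.comp h = k := huniq _ (fun x => by
    simp only [Hom.comp_apply]
    rw [hh x]; rfl)
  have e2 : Hom.id L M = k := huniq _ (fun x => rfl)
  have hc : c ∈ N := by
    have : N.subtype.toHom.comp h c = c := by rw [e1, ← e2]; rfl
    rw [← this]
    exact (h c).2
  obtain ⟨t, ht⟩ := Substructure.mem_closure_iff_exists_term.1 hc
  refine ⟨t.varFinset.image (fun x : I => (x : M)),
    t.restrictVar (fun x => ⟨x.1, Finset.mem_image_of_mem _ x.2⟩), ?_, ?_⟩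
  · intro x hx
    simp only [Finset.coe_image] at hx
    obtain ⟨y, -, rfl⟩ := hx
    exact y.2
  · rw [← ht]
    exact Term.realize_restrictVar _ (fun a => rfl)

theorem mkEquiv (hfun : ∀ n, IsEmpty (L.Relations n)) (F G : M →[L] M) (h1 : ∀ x, G (F x) = x)
    (h2 : ∀ x, F (G x) = x) : ∃ f : M ≃[L] M, ∀ x, f x = F x :=
  ⟨{ toFun := F, invFun := G, left_inv := h1, right_inv := h2,
     map_fun' := fun f x => F.map_fun f x
     map_rel' := fun r => ((hfun _).false r).elim }, fun _ => rfl⟩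

theorem free_id {T : L.Theory} {I : Set M} (hfree : IsFreeOn T M I) (F : M →[L] M)
    (h : ∀ i ∈ I, F i = i) (x : M) : F x = x := by
  obtain ⟨k, hk, huniq⟩ := hfree.2 M inferInstance hfree.1 (fun x => x)
  have e1 : F = k := huniq _ (fun x => h x x.2)
  have e2 : Hom.id L M = k := huniq _ (fun x => rfl)
  rw [e1, ← e2]; rfl

theorem perm_aut (hfun : ∀ n, IsEmpty (L.Relations n)) {T : L.Theory} {I : Set M}
    (hfree : IsFreeOn T M I) (σ : Equiv.Perm I) :
    ∃ f : M ≃[L] M, ∀ i : I, f i = σ i := by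
  obtain ⟨F, hF, -⟩ := hfree.2 M inferInstance hfree.1 (fun x => σ x)
  obtain ⟨G, hG, -⟩ := hfree.2 M inferInstance hfree.1 (fun x => σ.symm x)
  obtain ⟨f, hf⟩ := mkEquiv hfun F G
    (free_id hfree (G.comp F) (fun i hi => by
      rw [Hom.comp_apply, hF ⟨i, hi⟩, hG]; simp))
    (free_id hfree (F.comp G) (fun i hi => by
      rw [Hom.comp_apply, hG ⟨i, hi⟩, hF]; simp))
  exact ⟨f, fun i => by rw [hf, hF]⟩

theorem fin_aut (hfun : ∀ n, IsEmpty (L.Relations n)) {T : L.Theory} {I : Set M}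
    (hfree : IsFreeOn T M I) {ι : Type*} [Finite ι] (a b : ι → M)
    (ha : Function.Injective a) (hb : Function.Injective b) (haI : ∀ i, a i ∈ I)
    (hbI : ∀ i, b i ∈ I) : ∃ f : M ≃[L] M, (∀ i, f (a i) = b i) := by
  classical
  obtain ⟨n, ⟨e⟩⟩ := Finite.exists_equiv_fin ι
  let a' : Fin n ↪ I := ⟨fun i => ⟨a (e.symm i), haI _⟩, fun i j h => by
    simpa using ha (congrArg Subtype.val h)⟩
  let b' : Fin n ↪ I := ⟨fun i => ⟨b (e.symm i), hbI _⟩, fun i j h => by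
    simpa using hb (congrArg Subtype.val h)⟩
  have := Equiv.Perm.isMultiplyPretransitive I n
  obtain ⟨σ, hσ⟩ := MulAction.exists_smul_eq (Equiv.Perm I) a' b'
  obtain ⟨f, hf⟩ := perm_aut hfun hfree σ
  refine ⟨f, fun i => ?_⟩
  have h1 := congrArg Subtype.val (DFunLike.congr_fun hσ (e i))
  have h2 := hf (a' (e i))
  have h3 : ((a' (e i) : I) : M) = a i := congrArg a (e.symm_apply_apply i)
  have h4 : ((b' (e i) : I) : M) = b i := congrArg b (e.symm_apply_apply i)
  rw [h3] at h2
  rw [h4] at h1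
  rw [h2, ← h1]
  rfl

theorem onehom {T : L.Theory} {I : Set M} (hfree : IsFreeOn T M I)
    (supp : M → Finset M) (hsuppI : ∀ c, (↑(supp c) : Set M) ⊆ I)
    (hsupp : ∀ c, ∃ t : L.Term (supp c), t.realize (fun i : supp c => (i : M)) = c)
    (R : ℕ → Set (M × M)) (hmono : Monotone R) (hE : ∀ n, Elem L (R n))
    (hcl : ∀ n, ∀ p ∈ R n, ∀ x ∈ supp p.1, ∃ z, (x, z) ∈ R (n + 1)) (g : I → M) :
    ∃ F : M →[L] M, (∀ n, ∀ p ∈ R n, F p.1 = p.2) ∧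
      ∀ i : I, (¬ ∃ z, ∃ n, ((i : M), z) ∈ R n) → F i = g i := by
  classical
  obtain ⟨F, hF, -⟩ := hfree.2 M inferInstance hfree.1
    (fun i => if h : ∃ z, ∃ n, ((i : M), z) ∈ R n then h.choose else g i)
  have hfunc : ∀ x z z' n n', (x, z) ∈ R n → (x, z') ∈ R n' → z = z' := by
    intro x z z' n n' h h'
    have h := hmono (le_max_left n n') h
    have h' := hmono (le_max_right n n') h'
    have := hE (max n n') (Term.equal (Term.var ⟨_, h⟩) (Term.var ⟨_, h'⟩))
    simp only [Formula.realize_equal, Term.realize_var] at this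
    exact this.1 (by trivial)
  have hFI : ∀ i ∈ I, ∀ z n, (i, z) ∈ R n → F i = z := by
    intro i hi z n h
    have hex : ∃ z, ∃ n, (i, z) ∈ R n := ⟨z, n, h⟩
    have h1 := hF ⟨i, hi⟩
    simp only at h1
    rw [dif_pos hex] at h1
    rw [h1]
    obtain ⟨n', h'⟩ := hex.choose_spec
    exact hfunc _ _ _ _ _ h' h
  refine ⟨F, ?_, ?_⟩
  · rintro n ⟨x, y⟩ hp
    obtain ⟨t, ht⟩ := hsupp x
    choose z hz using fun i : supp x => hcl n _ hp i.1 i.2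
    have := hE (n + 1) (Term.equal (Term.var ⟨_, hmono (Nat.le_succ n) hp⟩)
      (t.relabel (fun i => ⟨_, hz i⟩)))
    simp only [Formula.realize_equal, Term.realize_var, Term.realize_relabel] at this
    have h2 := this.1 ht.symm
    simp only
    rw [h2]
    refine (congrArg F ht.symm).trans ?_
    rw [← HomClass.realize_term F]
    congr 1
    funext i
    exact hFI i (hsuppI x i.2) _ _ (hz i)
  · intro i hi
    have h1 := hF i
    rw [h1, dif_neg hi]

theorem back_forth (hfun : ∀ n, IsEmpty (L.Relations n)) {T : L.Theory} (hT : IsEquational T)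
    {I : Set M} (hcard : #I = ℵ₁) (hfree : IsFreeOn T M I) (hsat : IsSat (L := L) M ℵ₁)
    (a c : M) (h : ∀ φ : L.Formula (Fin 1), φ.Realize (fun _ => a) ↔ φ.Realize (fun _ => c)) :
    ∃ f : M ≃[L] M, f a = c ∧ ∃ K : Set M, K.Countable ∧ ∀ i ∈ I, i ∉ K → f i ∈ I := by
  classical
  choose supp hterm hsuppI hterm2 using gen hT hfree
  have hsupp : ∀ c, ∃ t : L.Term (supp c), t.realize (fun i : supp c => (i : M)) = c :=
    fun c => ⟨hterm c, hterm2 c⟩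
  have hS : Elem L ({(a, c)} : Set (M × M)) := by
    intro φ
    have := h (φ.relabel (fun _ => 0))
    simp only [Formula.realize_relabel] at this
    convert this using 2 <;>
    · funext p
      have : p.1 = (a, c) := p.2
      rw [this]; rfl
  obtain ⟨R, h0, hmono, hfin, hE, hc1, hc2⟩ := hS.chain hsat supp (Set.finite_singleton _)
  have hinf : ℵ₀ < #I := by rw [hcard]; exact aleph0_lt_aleph_one
  have : Infinite I := Cardinal.infinite_iff.2 hinf.le
  let D : Set M := Prod.fst '' (⋃ n, R n)
  let D' : Set M := Prod.snd '' (⋃ n, R n)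
  have hU : (⋃ n, R n).Countable := Set.countable_iUnion (fun n => (hfin n).countable)
  have hD : D.Countable := hU.image _
  have hD' : D'.Countable := hU.image _
  let K : Set I := Subtype.val ⁻¹' D
  let K' : Set I := Subtype.val ⁻¹' D'
  have hK : K.Countable := hD.preimage Subtype.val_injective
  have hK' : K'.Countable := hD'.preimage Subtype.val_injective
  have e1 : #(Kᶜ : Set I) = #I := Cardinal.mk_compl_of_infinite K (hK.le_aleph0.trans_lt hinf)
  have e2 : #(K'ᶜ : Set I) = #I := Cardinal.mk_compl_of_infinite K' (hK'.le_aleph0.trans_lt hinf)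
  obtain ⟨e⟩ := Cardinal.eq.1 (e1.trans e2.symm)
  obtain ⟨F, hF1, hF2⟩ := onehom hfree supp hsuppI hsupp R hmono hE hc1
    (fun i => if hi : i ∈ Kᶜ then ((e ⟨i, hi⟩).1 : M) else i)
  obtain ⟨G, hG1, hG2⟩ := onehom hfree supp hsuppI hsupp (fun n => Prod.swap ⁻¹' (R n))
    (fun m n hmn => Set.preimage_mono (hmono hmn)) (fun n => (hE n).swap)
    (fun n p hp x hx => hc2 n p.swap hp x hx)
    (fun i => if hi : i ∈ K'ᶜ then ((e.symm ⟨i, hi⟩).1 : M) else i)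
  have hKiff : ∀ i : I, (∃ z, ∃ n, ((i : M), z) ∈ R n) ↔ i ∈ K := by
    intro i; simp [K, D]
  have hKiff' : ∀ i : I, (∃ z, ∃ n, ((i : M), z) ∈ Prod.swap ⁻¹' (R n)) ↔ i ∈ K' := by
    intro i; simp [K', D']
  have hF3 : ∀ (i : I) (hi : i ∈ Kᶜ), F i = (e ⟨i, hi⟩).1 := by
    intro i hi
    rw [hF2 i (fun h => hi ((hKiff i).1 h)), dif_pos hi]
  have hG3 : ∀ (i : I) (hi : i ∈ K'ᶜ), G i = (e.symm ⟨i, hi⟩).1 := by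
    intro i hi
    rw [hG2 i (fun h => hi ((hKiff' i).1 h)), dif_pos hi]
  obtain ⟨f, hf⟩ := mkEquiv hfun F G
    (free_id hfree (G.comp F) (fun i hi => by
      rw [Hom.comp_apply]
      by_cases hiK : (⟨i, hi⟩ : I) ∈ K
      · obtain ⟨z, n, hz⟩ := (hKiff _).2 hiK
        rw [hF1 n _ hz]
        exact hG1 n (z, i) hz
      · rw [hF3 ⟨i, hi⟩ hiK, hG3 _ (e ⟨⟨i, hi⟩, hiK⟩).2]; simp))
    (free_id hfree (F.comp G) (fun i hi => by
      rw [Hom.comp_apply]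
      by_cases hiK : (⟨i, hi⟩ : I) ∈ K'
      · obtain ⟨z, n, hz⟩ := (hKiff' _).2 hiK
        rw [hG1 n _ hz]
        exact hF1 n (z, i) hz
      · rw [hG3 ⟨i, hi⟩ hiK, hF3 _ (e.symm ⟨⟨i, hi⟩, hiK⟩).2]; simp))
  refine ⟨f, ?_, D, hD, ?_⟩
  · rw [hf]
    exact hF1 0 (a, c) (by rw [← h0]; rfl)
  · intro i hi hiD
    rw [hf, hF3 ⟨i, hi⟩ hiD]
    exact (e ⟨⟨i, hi⟩, hiD⟩).1.2

/-! ### Morley rank -/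

theorem MRGe_iff {n : ℕ} (φ : L.Formula (M ⊕ Fin n)) (α : Ordinal.{0}) :
    MRGe φ α ↔ (∃ a, RealP φ a) ∧ ∀ β < α, ∃ ψ : ℕ → L.Formula (M ⊕ Fin n),
    (∀ i a, RealP (ψ i) a → RealP φ a) ∧
    (∀ i j, i ≠ j → ∀ a, ¬(RealP (ψ i) a ∧ RealP (ψ j) a)) ∧
    ∀ i, MRGe (ψ i) β := by
  rw [MRGe]

theorem MRGe.mono_ord {n : ℕ} {φ : L.Formula (M ⊕ Fin n)} {α β : Ordinal.{0}} (h : MRGe φ α)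
    (hβ : β ≤ α) : MRGe φ β := by
  rw [MRGe_iff] at h ⊢
  exact ⟨h.1, fun γ hγ => h.2 γ (hγ.trans_le hβ)⟩

theorem MRGe.mono {n : ℕ} {φ φ' : L.Formula (M ⊕ Fin n)} {α : Ordinal.{0}} (h : MRGe φ α)
    (hi : ∀ a, RealP φ a → RealP φ' a) : MRGe φ' α := by
  rw [MRGe_iff] at h ⊢
  obtain ⟨⟨a, ha⟩, h2⟩ := h
  refine ⟨⟨a, hi a ha⟩, fun β hβ => ?_⟩
  obtain ⟨ψ, h3, h4, h5⟩ := h2 β hβ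
  exact ⟨ψ, fun i a h => hi a (h3 i a h), h4, h5⟩

theorem MRGe.union {n : ℕ} (α : Ordinal.{0}) : ∀ (φ A B : L.Formula (M ⊕ Fin n)),
    (∀ a, RealP φ a → RealP A a ∨ RealP B a) → MRGe φ α → MRGe A α ∨ MRGe B α := by
  induction α using WellFoundedLT.induction with
  | ind α ih =>
  intro φ A B hAB h
  by_contra hcon
  push Not at hcon
  obtain ⟨hA, hB⟩ := hcon
  -- `Bad X β`: no infinite family in `X` at level `β`
  let Good : L.Formula (M ⊕ Fin n) → Ordinal.{0} → Prop := fun X β =>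
    ∃ ψ : ℕ → L.Formula (M ⊕ Fin n), (∀ i a, RealP (ψ i) a → RealP X a) ∧
    (∀ i j, i ≠ j → ∀ a, ¬(RealP (ψ i) a ∧ RealP (ψ j) a)) ∧ ∀ i, MRGe (ψ i) β
  have hGoodmono : ∀ X β γ, γ ≤ β → Good X β → Good X γ := by
    rintro X β γ hγ ⟨ψ, h1, h2, h3⟩
    exact ⟨ψ, h1, h2, fun i => (h3 i).mono_ord hγ⟩
  have hne : ∀ X β, Good X β → ∃ a, RealP X a := by
    rintro X β ⟨ψ, h1, h2, h3⟩
    obtain ⟨a, ha⟩ := ((MRGe_iff _ _).1 (h3 0)).1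
    exact ⟨a, h1 0 a ha⟩
  have hgood : ∀ β < α, Good A β ∨ Good B β := by
    intro β hβ
    obtain ⟨ψ, h1, h2, h3⟩ := ((MRGe_iff _ _).1 h).2 β hβ
    have hsplit : ∀ i, MRGe (ψ i ⊓ A) β ∨ MRGe (ψ i ⊓ B) β := fun i =>
      ih β hβ (ψ i) _ _ (fun a ha => by
        rcases hAB a (h1 i a ha) with h | h
        · left; exact Formula.realize_inf.2 ⟨ha, h⟩
        · right; exact Formula.realize_inf.2 ⟨ha, h⟩) (h3 i)
    have hmk : ∀ X, {i | MRGe (ψ i ⊓ X) β}.Infinite → Good X β := by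
      intro X hinf
      let e := hinf.natEmbedding
      refine ⟨fun k => ψ (e k) ⊓ X, fun i a ha => (Formula.realize_inf.1 ha).2, ?_, fun i => (e i).2⟩
      intro i j hij a ⟨ha, hb⟩
      exact h2 (e i) (e j) (fun h => hij (e.injective (Subtype.ext h))) a
        ⟨(Formula.realize_inf.1 ha).1, (Formula.realize_inf.1 hb).1⟩
    by_contra hc
    push Not at hc
    have f1 := Set.not_infinite.1 (fun h => hc.1 (hmk A h))
    have f2 := Set.not_infinite.1 (fun h => hc.2 (hmk B h))
    refine Set.infinite_univ (α := ℕ) ((f1.union f2).subset (fun i _ => hsplit i))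
  have hbad : ∀ X, ¬ MRGe X α → (∃ a, RealP X a) → ∃ β < α, ¬ Good X β := by
    intro X hX hXne
    by_contra hc
    push Not at hc
    exact hX ((MRGe_iff _ _).2 ⟨hXne, hc⟩)
  by_cases hAne : ∃ a, RealP A a
  · obtain ⟨β, hβ, hβ'⟩ := hbad A hA hAne
    by_cases hBne : ∃ a, RealP B a
    · obtain ⟨γ, hγ, hγ'⟩ := hbad B hB hBne
      rcases hgood (max β γ) (max_lt hβ hγ) with h | h
      · exact hβ' (hGoodmono _ _ _ (le_max_left _ _) h)
      · exact hγ' (hGoodmono _ _ _ (le_max_right _ _) h)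
    · exact hA (h.mono (fun a ha => (hAB a ha).resolve_right (fun h => hBne ⟨a, h⟩)))
  · exact hB (h.mono (fun a ha => (hAB a ha).resolve_left (fun h => hAne ⟨a, h⟩)))

theorem MRGe.finite_union {n : ℕ} {α : Ordinal.{0}} {κ : Type*} (s : Finset κ)
    (B : κ → L.Formula (M ⊕ Fin n)) : ∀ (φ : L.Formula (M ⊕ Fin n)),
    (∀ a, RealP φ a → ∃ k ∈ s, RealP (B k) a) → MRGe φ α → ∃ k ∈ s, MRGe (B k) α := by
  classical
  induction s using Finset.induction_on with
  | empty =>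
    intro φ h h1
    obtain ⟨a, ha⟩ := ((MRGe_iff _ _).1 h1).1
    simpa using h a ha
  | insert k s _ ih =>
    intro φ h h1
    rcases MRGe.union α φ (B k) (φ ⊓ (B k).not) (fun a ha => by
      by_cases hb : RealP (B k) a
      · exact Or.inl hb
      · exact Or.inr (Formula.realize_inf.2 ⟨ha, Formula.realize_not.2 hb⟩)) h1 with h2 | h2
    · exact ⟨k, Finset.mem_insert_self _ _, h2⟩
    · obtain ⟨j, hj, hj'⟩ := ih _ (fun a ha => by
        obtain ⟨ha1, ha2⟩ := Formula.realize_inf.1 ha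
        obtain ⟨j, hj, hj'⟩ := h a ha1
        rcases Finset.mem_insert.1 hj with rfl | hj
        · exact absurd hj' (Formula.realize_not.1 ha2)
        · exact ⟨j, hj, hj'⟩) h2
      exact ⟨j, Finset.mem_insert_of_mem hj, hj'⟩

theorem realP_aut {n : ℕ} (f : M ≃[L] M) (φ : L.Formula (M ⊕ Fin n)) (a : Fin n → M) :
    RealP (φ.relabel (Sum.map f id)) (f ∘ a) ↔ RealP φ a := by
  unfold RealP
  rw [Formula.realize_relabel, ← StrongHomClass.realize_formula f φ (v := Sum.elim id a)]
  apply iff_of_eq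
  congr 1
  funext i
  rcases i with i | i <;> rfl

theorem realP_aut' {n : ℕ} (f : M ≃[L] M) (φ : L.Formula (M ⊕ Fin n)) (a : Fin n → M) :
    RealP (φ.relabel (Sum.map f id)) a ↔ RealP φ (f.symm ∘ a) := by
  rw [← realP_aut f φ (f.symm ∘ a)]
  have : f ∘ (f.symm ∘ a) = a := by
    funext i
    simp
  rw [this]

theorem MRGe.aut {n : ℕ} (f : M ≃[L] M) (α : Ordinal.{0}) : ∀ (φ : L.Formula (M ⊕ Fin n)),
    MRGe φ α → MRGe (φ.relabel (Sum.map f id) : L.Formula (M ⊕ Fin n)) α := by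
  induction α using WellFoundedLT.induction with
  | ind α ih =>
  intro φ h
  rw [MRGe_iff] at h ⊢
  obtain ⟨⟨a, ha⟩, h2⟩ := h
  refine ⟨⟨f ∘ a, (realP_aut f φ a).2 ha⟩, fun β hβ => ?_⟩
  obtain ⟨ψ, h3, h4, h5⟩ := h2 β hβ
  refine ⟨fun i => (ψ i).relabel (Sum.map f id), ?_, ?_, fun i => ih β hβ _ (h5 i)⟩
  · intro i a
    rw [realP_aut', realP_aut']
    exact h3 i _
  · intro i j hij a
    rw [realP_aut', realP_aut']
    exact h4 i j hij _

/-! ### Main argument -/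

theorem exists_inj {I X : Set M} (hI : ¬ I.Countable) (hX : X.Countable) (ι : Type*) [Countable ι] :
    ∃ b : ι → M, Function.Injective b ∧ ∀ i, b i ∈ I ∧ b i ∉ X := by
  have hinf : (I \ X).Infinite := fun h => hI ((h.countable.union hX).mono (by
    intro x hx
    by_cases h : x ∈ X
    · exact Or.inr h
    · exact Or.inl ⟨hx, h⟩))
  obtain ⟨g, hg⟩ := exists_injective_nat ι
  exact ⟨fun i => hinf.natEmbedding _ (g i),
    fun i j h => hg ((hinf.natEmbedding _).injective (Subtype.ext h)),
    fun i => (hinf.natEmbedding _ (g i)).2⟩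

theorem main_rank (hfun : ∀ n, IsEmpty (L.Relations n)) {T : L.Theory} (hT : IsEquational T)
    {I : Set M} (hcard : #I = ℵ₁) (hfree : IsFreeOn T M I) (hsat : IsSat (L := L) M ℵ₁)
    {a : M} (ha : a ∈ I) (α : Ordinal.{0})
    (hα : TpRkGe (L := L) (∅ : Set M) (fun _ : Fin 1 => a) α)
    {ι : Type w} [Finite ι] (b : ι → M) (hb : Function.Injective b) (hbI : ∀ i, b i ∈ I)
    (hba : ∀ i, b i ≠ a) (φ : L.Formula (ι ⊕ Fin 1))
    (hφ : φ.Realize (Sum.elim b (fun _ => a))) :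
    MRGe (φ.relabel (Sum.map b id) : L.Formula (M ⊕ Fin 1)) α := by
  classical
  have hunc : ¬ I.Countable := by
    rw [countable_iff_lt_aleph_one, hcard]; exact lt_irrefl _
  obtain ⟨e, he, heI⟩ := exists_inj hunc (Set.countable_singleton a) (ℕ × ι)
  let A : Set M := Set.range e
  have hA : #A < ℵ₁ := (countable_iff_lt_aleph_one A).1 (Set.countable_range e)
  let g : ℕ → ι ⊕ Fin 1 → A ⊕ Fin 1 :=
    fun j => Sum.map (fun i => ⟨e (j, i), Set.mem_range_self _⟩) id
  have hg : ∀ j (x : Fin 1 → M), (Sum.elim (fun x : A => (x : M)) x) ∘ g j =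
      Sum.elim (fun i => e (j, i)) x := by
    intro j x; funext i; rcases i with i | i <;> rfl
  -- moving lemma
  have move : ∀ (b₁ b₂ : ι → M) (c : M) (s : Finset M) (t : L.Term s),
      t.realize (fun i : s => (i : M)) = c → (↑s : Set M) ⊆ I →
      Function.Injective b₁ → Function.Injective b₂ → (∀ i, b₁ i ∈ I) → (∀ i, b₂ i ∈ I) →
      (∀ i, b₁ i ∉ s) → (∀ i, b₂ i ∉ s) →
      φ.Realize (Sum.elim b₁ (fun _ => c)) → φ.Realize (Sum.elim b₂ (fun _ => c)) := by
    intro b₁ b₂ c s t ht hs i1 i2 m1 m2 n1 n2 h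
    obtain ⟨f, hf⟩ := fin_aut hfun hfree (Sum.elim (fun i : s => (i : M)) b₁)
      (Sum.elim (fun i : s => (i : M)) b₂)
      (Subtype.val_injective.sumElim i1 (fun x i h => n1 i (h ▸ x.2)))
      (Subtype.val_injective.sumElim i2 (fun x i h => n2 i (h ▸ x.2)))
      (by rintro (i | i); exacts [hs i.2, m1 i]) (by rintro (i | i); exacts [hs i.2, m2 i])
    have hc : f c = c := by
      rw [← ht, ← HomClass.realize_term f]
      congr 1
      funext i
      exact hf (Sum.inl i)
    rw [← StrongHomClass.realize_formula f] at h
    convert h using 2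
    funext i
    rcases i with i | i
    · exact (hf (Sum.inr i)).symm
    · exact hc.symm
  -- key claim
  have claim : ∃ χ : L.Formula (Fin 1), χ.Realize (fun _ => a) ∧ ∃ s : Finset ℕ,
      ∀ x : Fin 1 → M, χ.Realize x → ∃ j ∈ s, φ.Realize (Sum.elim (fun i => e (j, i)) x) := by
    by_contra hcon
    push Not at hcon
    obtain ⟨c, hc⟩ := hsat A hA
      ((fun χ : L.Formula (Fin 1) => (χ.relabel Sum.inr : L.Formula (A ⊕ Fin 1))) ''
        {χ | χ.Realize (fun _ => a)} ∪ Set.range (fun j : ℕ => (φ.relabel (g j)).not)) (by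
      intro S hS
      have hS' : ∀ ψ : S, ∃ (χ : L.Formula (Fin 1)) (j : ℕ), χ.Realize (fun _ => a) ∧
          ∀ x : Fin 1 → M, χ.Realize x → ¬ φ.Realize (Sum.elim (fun i => e (j, i)) x) →
            ψ.1.Realize (Sum.elim (fun x : A => (x : M)) x) := by
        rintro ⟨ψ, hψ⟩
        rcases hS hψ with ⟨χ, h1, rfl⟩ | ⟨j, rfl⟩
        · refine ⟨χ, 0, h1, fun x hx _ => ?_⟩
          rw [Formula.realize_relabel]
          exact hx
        · refine ⟨⊤, j, by simp, fun x _ hx => ?_⟩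
          rw [Formula.realize_not, Formula.realize_relabel, hg]
          exact hx
      choose χ j h1 h2 using hS'
      obtain ⟨x, hx1, hx2⟩ := hcon (Formula.iInf χ) (Formula.realize_iInf.2 h1)
        (Finset.univ.image j)
      rw [Formula.realize_iInf] at hx1
      exact ⟨x, fun ψ hψ => h2 ⟨ψ, hψ⟩ x (hx1 _)
        (hx2 _ (Finset.mem_image_of_mem _ (Finset.mem_univ _)))⟩)
    have hc1 : ∀ χ : L.Formula (Fin 1), χ.Realize (fun _ => a) → χ.Realize (fun _ => c 0) := by
      intro χ hχ
      have := hc _ (Or.inl ⟨χ, hχ, rfl⟩)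
      rw [Formula.realize_relabel] at this
      convert this using 2
      rename_i i
      rw [Subsingleton.elim i 0]; rfl
    have hc2 : ∀ j, ¬ φ.Realize (Sum.elim (fun i => e (j, i)) (fun _ => c 0)) := by
      intro j
      have := hc _ (Or.inr ⟨j, rfl⟩)
      rw [Formula.realize_not, Formula.realize_relabel, hg] at this
      convert this using 4
      rename_i i
      rw [Subsingleton.elim i 0]
    obtain ⟨f, hfa, K, hK, hfK⟩ := back_forth hfun hT hcard hfree hsat a (c 0) (fun χ =>
      ⟨hc1 χ, fun h1 => by
        by_contra h2
        have := hc1 χ.not (Formula.realize_not.2 h2)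
        exact Formula.realize_not.1 this h1⟩)
    obtain ⟨s, t, hs, ht⟩ := gen hT hfree (c 0)
    have hX : (K ∪ {a} ∪ f ⁻¹' (↑s : Set M)).Countable :=
      (hK.union (Set.countable_singleton a)).union
        ((s.finite_toSet.preimage f.injective.injOn).countable)
    obtain ⟨b', hb', hb'I⟩ := exists_inj hunc hX ι
    have g1 : φ.Realize (Sum.elim b' (fun _ => a)) := by
      refine move b b' a {a} (Term.var ⟨a, Finset.mem_singleton_self a⟩) rfl (by simpa using ha)
        hb hb' hbI (fun i => (hb'I i).1) (fun i => by simpa using hba i) (fun i => ?_) hφ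
      have := (hb'I i).2
      simp only [Set.mem_union, not_or] at this
      simpa using this.1.2
    have g2 : φ.Realize (Sum.elim (f ∘ b') (fun _ => c 0)) := by
      rw [← StrongHomClass.realize_formula f] at g1
      convert g1 using 2
      funext i
      rcases i with i | i
      · rfl
      · exact hfa.symm
    -- find `j` with `e (j, ·)` disjoint from `s`
    have hj : ∃ j, ∀ i, e (j, i) ∉ s := by
      by_contra hno
      push Not at hno
      choose i hi using hno
      refine Set.infinite_univ (α := ℕ) (Set.Finite.subset
        (s.finite_toSet.preimage (f := fun j => e (j, i j)) ?_) (fun j _ => hi j))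
      intro j _ j' _ h
      exact congrArg Prod.fst (he h)
    obtain ⟨j, hj⟩ := hj
    refine hc2 j (move (f ∘ b') _ (c 0) s t ht hs (f.injective.comp hb')
      (fun i i' h => congrArg Prod.snd (he h)) (fun i => ?_) (fun i => (heI _).1) (fun i => ?_)
      hj g2)
    · have := (hb'I i).2
      simp only [Set.mem_union, not_or] at this
      exact hfK _ (hb'I i).1 this.1.1
    · have := (hb'I i).2
      simp only [Set.mem_union, not_or] at this
      exact this.2
  obtain ⟨χ, hχa, s, hχ⟩ := claim
  have h1 := hα (χ.relabel Sum.inr) (by rw [Formula.realize_relabel]; exact hχa)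
  obtain ⟨j, -, hj⟩ := MRGe.finite_union s
    (fun j => (φ.relabel (Sum.map (fun i => e (j, i)) id) : L.Formula (M ⊕ Fin 1))) _ (by
      intro x hx
      unfold RealP at hx
      rw [Formula.realize_relabel, Formula.realize_relabel] at hx
      obtain ⟨j, hj, hj'⟩ := hχ x hx
      refine ⟨j, hj, ?_⟩
      unfold RealP
      rw [Formula.realize_relabel]
      convert hj' using 2
      funext i
      rcases i with i | i <;> rfl) h1
  obtain ⟨f, hf⟩ := fin_aut hfun hfree (fun i => e (j, i)) b
    (fun i i' h => congrArg Prod.snd (he h)) hb (fun i => (heI _).1) hbI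
  refine (hj.aut f).mono (fun x hx => ?_)
  unfold RealP at hx ⊢
  rw [Formula.realize_relabel, Formula.realize_relabel] at hx
  rw [Formula.realize_relabel]
  have heq : (Sum.elim id x ∘ Sum.map (⇑f) id) ∘ Sum.map (fun i => e (j, i)) id =
      Sum.elim id x ∘ Sum.map b id := by
    funext i
    rcases i with i | i
    · exact hf i
    · rfl
  rw [heq] at hx
  exact hx

end Aux

end Paper

open Paper in
/-- the basis of a saturated free algebra is a Morley sequence in `p₀`:
an indiscernible set which is independent over `∅`. -/
theorem stmt_10 {L : FirstOrder.Language.{u, v}} (hfun : ∀ n, IsEmpty (L.Relations n))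
    (T : L.Theory) (hT : IsEquational T)
    (M : Type w) [L.Structure M] (I : Set M) (hcard : #I = ℵ₁)
    (hfree : IsFreeOn T M I) (hsat : IsSat (L := L) M ℵ₁) :
    (∀ (n : ℕ) (a b : Fin n → M), Function.Injective a → Function.Injective b →
      (∀ i, a i ∈ I) → (∀ i, b i ∈ I) →
      ∀ φ : L.Formula (Fin n), φ.Realize a ↔ φ.Realize b) ∧
    (∀ a ∈ I, Indep (L := L) (∅ : Set M) (fun _ : Fin 1 => a) (I \ {a})) := by
  classical
  refine ⟨?_, ?_⟩
  · intro n a b ha hb haI hbI φ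
    obtain ⟨f, hf⟩ := fin_aut hfun hfree a b ha hb haI hbI
    rw [← StrongHomClass.realize_formula f]
    apply iff_of_eq
    congr 1
    funext i
    exact hf i
  · intro a ha α
    constructor
    · intro h φ hφ
      have := h (φ.relabel (Sum.map (fun x => ⟨x.1, Or.inl x.2⟩) id)) (by
        rw [Formula.realize_relabel]
        convert hφ using 2
        funext i
        rcases i with i | i <;> rfl)
      refine this.mono (fun x hx => ?_)
      unfold RealP at hx ⊢
      rw [Formula.realize_relabel, Formula.realize_relabel] at hx
      rw [Formula.realize_relabel]
      convert hx using 2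
      funext i
      rcases i with i | i <;> rfl
    · intro h φ hφ
      let t : Finset ↥((∅ : Set M) ∪ I \ {a}) := φ.freeVarFinset.toLeft
      let g : φ.freeVarFinset → t ⊕ Fin 1 := fun x =>
        match x with
        | ⟨Sum.inl y, hy⟩ => Sum.inl ⟨y, Finset.mem_toLeft.2 hy⟩
        | ⟨Sum.inr k, _⟩ => Sum.inr k
      let φ' : L.Formula (t ⊕ Fin 1) := BoundedFormula.restrictFreeVar φ g
      have key : ∀ x : Fin 1 → M, φ'.Realize (Sum.elim (fun i : t => (i.1 : M)) x) ↔
          φ.Realize (Sum.elim (fun i => (i : M)) x) := by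
        intro x
        refine BoundedFormula.realize_restrictFreeVar _ ?_
        rintro ⟨y | k, hy⟩ <;> rfl
      have hmem : ∀ i : t, (i.1 : M) ∈ I ∧ (i.1 : M) ≠ a := by
        intro i
        rcases i.1.2 with h | h
        · exact absurd h (Set.notMem_empty _)
        · exact ⟨h.1, h.2⟩
      have := main_rank hfun hT hcard hfree hsat ha α h (fun i : t => (i.1 : M))
        (fun i j h => Subtype.ext (Subtype.ext h)) (fun i => (hmem i).1) (fun i => (hmem i).2) φ'
        ((key _).2 hφ)
      refine this.mono (fun x hx => ?_)
      unfold RealP at hx ⊢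
      rw [Formula.realize_relabel] at hx ⊢
      have h2 := (key x).1 (by
        convert hx using 2
        funext i
        rcases i with i | i <;> rfl)
      convert h2 using 2
      funext i
      rcases i with i | i <;> rfl
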